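/- arXiv:2110.08106 — 2 statements merged into one kernel-verified Lean document; each statement's English description precedes it below -/
import Mathlib

section
/- For every d ∈ ℕ there exists a constant c_d such that the following holds: if M is an n×n binary matrix that is d-twin-ordered, then for every t ∈ ℕ, the total number of vertical and horizontal strips in any t-division of M is at most c_d·t. -/
/- A binary matrix with `n` rows and `m` columns is modelled as `M : ℕ → ℕ → Bool`,
with the relevant entries `M x y` for `x < n`, `y < m`. Generalized submatrices are
described by a row-index predicate `P` and a column-index predicate `Q`. -/

/-- The submatrix of `M` with rows `P` and columns `Q` is horizontal:
all its columns are equal (equivalently, all its rows are constant). -/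
def IsHoriz (M : ℕ → ℕ → Bool) (P Q : ℕ → Prop) : Prop :=
  ∀ x y y', P x → Q y → Q y' → M x y = M x y'

/-- The submatrix of `M` with rows `P` and columns `Q` is vertical:
all its rows are equal (equivalently, all its columns are constant). -/
def IsVert (M : ℕ → ℕ → Bool) (P Q : ℕ → Prop) : Prop :=
  ∀ x x' y, P x → P x' → Q y → M x y = M x' y

/-- The submatrix of `M` with rows `P` and columns `Q` is constant. -/
def IsConst (M : ℕ → ℕ → Bool) (P Q : ℕ → Prop) : Prop :=
  ∀ x y x' y', P x → Q y → P x' → Q y' → M x y = M x' y'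

/-- Mixed: neither horizontal nor vertical. -/
def IsMixed (M : ℕ → ℕ → Bool) (P Q : ℕ → Prop) : Prop :=
  ¬ IsHoriz M P Q ∧ ¬ IsVert M P Q

/-- A partition of the index interval `[0,n)` into consecutive nonempty blocks is recorded
by its finite set `S` of block starts: it must contain `0` and have all elements `< n`. -/
def IsPartition (n : ℕ) (S : Finset ℕ) : Prop :=
  0 ∈ S ∧ ∀ s ∈ S, s < n

/-- `x` belongs to the block of the partition (of `[0,n)`) with starts `S`
that starts at `s`: `s ≤ x < n`, and no start of `S` lies in `(s, x]`. -/
def InBlock (S : Finset ℕ) (n s x : ℕ) : Prop :=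
  x < n ∧ s ≤ x ∧ ∀ t ∈ S, t ≤ x → t ≤ s

/-- The division of the `n × m` matrix `M` given by row-block starts `R` and
column-block starts `C` has error value at most `d`: every row block and every
column block contains at most `d` non-constant zones. -/
def ErrorValueLe (M : ℕ → ℕ → Bool) (n m : ℕ) (R C : Finset ℕ) (d : ℕ) : Prop :=
  (∀ sr ∈ R, {sc | sc ∈ C ∧ ¬ IsConst M (InBlock R n sr) (InBlock C m sc)}.ncard ≤ d) ∧
  (∀ sc ∈ C, {sr | sr ∈ R ∧ ¬ IsConst M (InBlock R n sr) (InBlock C m sc)}.ncard ≤ d)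

/-- The `n × m` binary matrix `M` is `d`-twin-ordered: there is a contraction sequence,
from the finest division to the coarsest one, each division being obtained from the
previous one by merging two consecutive row blocks or two consecutive column blocks
(i.e. deleting one block start), in which every division has error value at most `d`. -/
def TwinOrdered (n m d : ℕ) (M : ℕ → ℕ → Bool) : Prop :=
  ∃ D : ℕ → Finset ℕ × Finset ℕ,
    D 0 = (Finset.range n, Finset.range m) ∧
    D ((n - 1) + (m - 1)) = ({0}, {0}) ∧
    (∀ k, k < (n - 1) + (m - 1) →
      ((D (k+1)).1 ⊆ (D k).1 ∧ (D k).1.card = (D (k+1)).1.card + 1 ∧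
        (D (k+1)).2 = (D k).2) ∨
      ((D (k+1)).2 ⊆ (D k).2 ∧ (D k).2.card = (D (k+1)).2.card + 1 ∧
        (D (k+1)).1 = (D k).1)) ∧
    (∀ k, k ≤ (n - 1) + (m - 1) → ErrorValueLe M n m (D k).1 (D k).2 d)

/-- `a` and `b` are consecutive block starts in `S` (with `a < b`). -/
def ConsecIn (S : Finset ℕ) (a b : ℕ) : Prop :=
  a ∈ S ∧ b ∈ S ∧ a < b ∧ ∀ s ∈ S, a < s → b ≤ s

/-- The zone of the division `(R, C)` at block starts `(sr, sc)` is non-constant vertical. -/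
def NCVertZone (M : ℕ → ℕ → Bool) (n m : ℕ) (R C : Finset ℕ) (sr sc : ℕ) : Prop :=
  IsVert M (InBlock R n sr) (InBlock C m sc) ∧
    ¬ IsConst M (InBlock R n sr) (InBlock C m sc)

/-- The zone of the division `(R, C)` at block starts `(sr, sc)` is non-constant
horizontal. -/
def NCHorizZone (M : ℕ → ℕ → Bool) (n m : ℕ) (R C : Finset ℕ) (sr sc : ℕ) : Prop :=
  IsHoriz M (InBlock R n sr) (InBlock C m sc) ∧
    ¬ IsConst M (InBlock R n sr) (InBlock C m sc)

/-- The zone at `(sr, sc)` is the top-most zone of a vertical strip of `(R, C)`: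
it is non-constant vertical, and it cannot be extended upwards (the zone directly above
either does not exist, or is not non-constant vertical, or their union is not vertical).
Vertical strips are in bijection with their top-most zones. -/
def VertStripTop (M : ℕ → ℕ → Bool) (n m : ℕ) (R C : Finset ℕ) (sr sc : ℕ) : Prop :=
  sr ∈ R ∧ sc ∈ C ∧ NCVertZone M n m R C sr sc ∧
    ∀ sr', ConsecIn R sr' sr →
      ¬ (NCVertZone M n m R C sr' sc ∧
          IsVert M (fun x => InBlock R n sr' x ∨ InBlock R n sr x) (InBlock C m sc))

/-- The zone at `(sr, sc)` is the left-most zone of a horizontal strip of `(R, C)`.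
Horizontal strips are in bijection with their left-most zones. -/
def HorizStripLeft (M : ℕ → ℕ → Bool) (n m : ℕ) (R C : Finset ℕ) (sr sc : ℕ) : Prop :=
  sr ∈ R ∧ sc ∈ C ∧ NCHorizZone M n m R C sr sc ∧
    ∀ sc', ConsecIn C sc' sc →
      ¬ (NCHorizZone M n m R C sr sc' ∧
          IsHoriz M (InBlock R n sr) (fun y => InBlock C m sc' y ∨ InBlock C m sc y))

theorem isHoriz_transpose (M : ℕ → ℕ → Bool) (P Q : ℕ → Prop) :
    IsHoriz (fun y x => M x y) Q P ↔ IsVert M P Q :=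
  ⟨fun h x x' y hx hx' hy => h y x x' hy hx hx', fun h y x x' hy hx hx' => h x x' y hx hx' hy⟩

theorem isVert_transpose (M : ℕ → ℕ → Bool) (P Q : ℕ → Prop) :
    IsVert (fun y x => M x y) Q P ↔ IsHoriz M P Q :=
  ⟨fun h x y y' hx hy hy' => h y y' x hy hy' hx, fun h y y' x hy hy' hx => h x y y' hx hy hy'⟩

theorem isConst_transpose (M : ℕ → ℕ → Bool) (P Q : ℕ → Prop) :
    IsConst (fun y x => M x y) Q P ↔ IsConst M P Q :=
  ⟨fun h x y x' y' hx hy hx' hy' => h y x y' x' hy hx hy' hx',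
    fun h y x y' x' hy hx hy' hx' => h x y x' y' hx hy hx' hy'⟩

theorem isMixed_transpose (M : ℕ → ℕ → Bool) (P Q : ℕ → Prop) :
    IsMixed (fun y x => M x y) Q P ↔ IsMixed M P Q :=
  and_comm.trans
    (and_congr (not_congr (isVert_transpose M P Q)) (not_congr (isHoriz_transpose M P Q)))

theorem ErrorValueLe.transpose {M : ℕ → ℕ → Bool} {n m d : ℕ} {R C : Finset ℕ}
    (h : ErrorValueLe M n m R C d) : ErrorValueLe (fun y x => M x y) m n C R d := by
  unfold ErrorValueLe
  simp only [isConst_transpose]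
  exact ⟨h.2, h.1⟩

theorem TwinOrdered.transpose {M : ℕ → ℕ → Bool} {n m d : ℕ}
    (h : TwinOrdered n m d M) : TwinOrdered m n d (fun y x => M x y) := by
  obtain ⟨D, h0, hl, hs, he⟩ := h
  refine ⟨fun k => (D k).swap, ?_, ?_, fun k hk => ?_, fun k hk => ?_⟩
  · simp [h0]
  · rw [add_comm]
    simp [hl]
  · rw [add_comm] at hk
    exact (hs k hk).symm
  · rw [add_comm] at hk
    exact (he k hk).transpose

theorem horizStripLeft_iff_vertStripTop_transpose (M : ℕ → ℕ → Bool) (n m : ℕ)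
    (R C : Finset ℕ) (sr sc : ℕ) :
    HorizStripLeft M n m R C sr sc ↔ VertStripTop (fun y x => M x y) m n C R sc sr := by
  unfold HorizStripLeft VertStripTop NCHorizZone NCVertZone
  simp only [isVert_transpose, isConst_transpose]
  tauto

/-- `P`, indexed by `A`, is a family of subintervals of `[0,n)` such that every point lies
in at most two of them. -/
structure IsIntervalFamily (n : ℕ) (A : Finset ℕ) (P : ℕ → ℕ → Prop) : Prop where
  lt : ∀ s x, P s x → x < n
  convex : ∀ s x y z, P s x → P s z → x ≤ y → y ≤ z → P s y
  overlap : ∀ x, {s | s ∈ A ∧ P s x}.ncard ≤ 2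

theorem finite_sep_mem (A : Finset ℕ) (p : ℕ → Prop) : {s | s ∈ A ∧ p s}.Finite :=
  A.finite_toSet.subset fun _ hs => hs.1

theorem IsIntervalFamily.mono {n : ℕ} {A B : Finset ℕ} {P : ℕ → ℕ → Prop}
    (h : IsIntervalFamily n A P) (hBA : B ⊆ A) : IsIntervalFamily n B P where
  lt := h.lt
  convex := h.convex
  overlap x := by
    have hsub : {s | s ∈ B ∧ P s x} ⊆ {s | s ∈ A ∧ P s x} := fun _ hs => ⟨hBA hs.1, hs.2⟩
    exact (Set.ncard_le_ncard hsub (finite_sep_mem _ _)).trans (h.overlap x)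

theorem exists_inBlock {S : Finset ℕ} {n x : ℕ} (h0 : 0 ∈ S) (hx : x < n) :
    ∃ b ∈ S, InBlock S n b x := by
  have hne : (S.filter (· ≤ x)).Nonempty := ⟨0, by simp [h0]⟩
  have hmem := Finset.max'_mem _ hne
  rw [Finset.mem_filter] at hmem
  exact ⟨_, hmem.1, hx, hmem.2, fun t ht htx => Finset.le_max' _ _ (by simp [ht, htx])⟩

/-- A block containing no interval of the family meets at most four of its intervals. -/
theorem IsIntervalFamily.ncard_meeting_le {n : ℕ} {A : Finset ℕ} {P : ℕ → ℕ → Prop}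
    (h : IsIntervalFamily n A P) (S : Finset ℕ) (b : ℕ)
    (hno : ∀ s ∈ A, ¬ ∀ x, P s x → InBlock S n b x) :
    {s | s ∈ A ∧ ∃ x, P s x ∧ InBlock S n b x}.ncard ≤ 4 := by
  classical
  set e := Nat.findGreatest (InBlock S n b) n with he
  have hsub : {s | s ∈ A ∧ ∃ x, P s x ∧ InBlock S n b x} ⊆
      {s | s ∈ A ∧ P s b} ∪ {s | s ∈ A ∧ P s e} := by
    rintro s ⟨hs, x, hPx, hx⟩
    have hz := hno s hs
    push Not at hz
    obtain ⟨z, hPz, hz⟩ := hz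
    rcases lt_or_ge z b with hzb | hzb
    · exact Or.inl ⟨hs, h.convex s z b x hPz hPx hzb.le hx.2.1⟩
    · right
      have hxe : x ≤ e := Nat.le_findGreatest hx.1.le hx
      have hblock : InBlock S n b e := Nat.findGreatest_spec hx.1.le hx
      have hez : e ≤ z := by
        by_contra hlt
        push Not at hlt
        exact hz ⟨hlt.trans hblock.1, hzb, fun t ht htz => hblock.2.2 t ht (htz.trans hlt.le)⟩
      exact ⟨hs, h.convex s x e z hPx hPz hxe hez⟩
  calc _ ≤ _ := Set.ncard_le_ncard hsub ((finite_sep_mem _ _).union (finite_sep_mem _ _))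
    _ ≤ _ := Set.ncard_union_le _ _
    _ ≤ 2 + 2 := add_le_add (h.overlap b) (h.overlap e)

/-- If the rows `P` lie in one row block of a division, and no interval of the column family
`Q` lies in a column block, then few zones `P × Q u` are mixed. -/
theorem ncard_mixed_le_of_subset_block {M : ℕ → ℕ → Bool} {n m d : ℕ} {S T B : Finset ℕ}
    {P : ℕ → Prop} {Q : ℕ → ℕ → Prop} (hQ : IsIntervalFamily m B Q) (h0 : 0 ∈ T)
    (he : ErrorValueLe M n m S T d) {a : ℕ} (ha : a ∈ S) (hP : ∀ x, P x → InBlock S n a x)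
    (hno : ∀ u ∈ B, ∀ c ∈ T, ¬ ∀ y, Q u y → InBlock T m c y) :
    {u | u ∈ B ∧ IsMixed M P (Q u)}.ncard ≤ 4 * d := by
  classical
  set N := T.filter fun c => ¬ IsConst M (InBlock S n a) (InBlock T m c) with hN
  have hNd : N.card ≤ d := by
    have := he.1 a ha
    rw [← Set.ncard_coe_finset, hN, Finset.coe_filter]
    exact this
  have hsub : {u | u ∈ B ∧ IsMixed M P (Q u)} ⊆
      (N.biUnion fun c => B.filter fun u => ∃ y, Q u y ∧ InBlock T m c y : Finset ℕ) := by
    rintro u ⟨hu, hmix⟩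
    by_contra hcon
    refine hmix.2 fun x x' y hx hx' hy => ?_
    obtain ⟨c, hc, hyc⟩ := exists_inBlock h0 (hQ.lt u y hy)
    by_cases hconst : IsConst M (InBlock S n a) (InBlock T m c)
    · exact hconst x y x' y (hP x hx) hyc (hP x' hx') hyc
    · exfalso
      apply hcon
      simp only [Finset.coe_biUnion, Set.mem_iUnion, Finset.mem_coe, Finset.mem_filter, hN]
      exact ⟨c, ⟨hc, hconst⟩, hu, y, hy, hyc⟩
  have hcard := Finset.card_biUnion_le_card_mul N
    (fun c => B.filter fun u => ∃ y, Q u y ∧ InBlock T m c y) 4 (fun c hc => by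
      rw [← Set.ncard_coe_finset, Finset.coe_filter]
      exact hQ.ncard_meeting_le T c fun u hu => hno u hu c (Finset.mem_filter.1 hc).1)
  calc _ ≤ _ := Set.ncard_le_ncard hsub (Finset.finite_toSet _)
    _ = _ := Set.ncard_coe_finset _
    _ ≤ N.card * 4 := hcard
    _ ≤ 4 * d := by omega

/-- A single row induces no mixed zone. -/
theorem ncard_mixed_eq_zero_of_subset_singleton {M : ℕ → ℕ → Bool} {n a : ℕ} {B : Finset ℕ}
    {P : ℕ → Prop} {Q : ℕ → ℕ → Prop} (hP : ∀ x, P x → InBlock (Finset.range n) n a x) :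
    {u | u ∈ B ∧ IsMixed M P (Q u)}.ncard = 0 := by
  have hempty : {u | u ∈ B ∧ IsMixed M P (Q u)} = ∅ := by
    ext u
    simp only [Set.mem_ofPred_eq, Set.mem_empty_iff_false, iff_false, not_and]
    intro _ hmix
    refine hmix.2 fun x x' y hx hx' _ => ?_
    have heq : ∀ x, P x → x = a := fun x hx =>
      le_antisymm ((hP x hx).2.2 x (Finset.mem_range.2 (hP x hx).1) le_rfl) (hP x hx).2.1
    rw [heq x hx, heq x' hx']
  rw [hempty, Set.ncard_empty]

/-- In a twin-ordered matrix, some interval of one of the two families induces few mixed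
zones. -/
theorem TwinOrdered.exists_few_mixed {M : ℕ → ℕ → Bool} {n m d : ℕ} (h : TwinOrdered n m d M)
    {A B : Finset ℕ} {P Q : ℕ → ℕ → Prop} (hP : IsIntervalFamily n A P)
    (hQ : IsIntervalFamily m B Q) (hA : A.Nonempty) :
    (∃ s ∈ A, {u | u ∈ B ∧ IsMixed M (P s) (Q u)}.ncard ≤ 4 * d) ∨
      (∃ u ∈ B, {s | s ∈ A ∧ IsMixed M (P s) (Q u)}.ncard ≤ 4 * d) := by
  classical
  obtain ⟨D, h0, hl, hs, he⟩ := h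
  set l := (n - 1) + (m - 1) with hldef
  have hz : ∀ k ≤ l, 0 ∈ (D k).1 ∧ 0 ∈ (D k).2 := by
    intro k hk
    induction hk using Nat.decreasingInduction with
    | self => simp [hl]
    | of_succ k hk ih =>
      rcases hs k hk with ⟨hsub, _, heq⟩ | ⟨hsub, _, heq⟩
      · exact ⟨hsub ih.1, heq ▸ ih.2⟩
      · exact ⟨heq ▸ ih.1, hsub ih.2⟩
  have hex : ∃ k, k ≤ l ∧ ((∃ s ∈ A, ∃ a ∈ (D k).1, ∀ x, P s x → InBlock (D k).1 n a x) ∨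
      (∃ u ∈ B, ∃ c ∈ (D k).2, ∀ y, Q u y → InBlock (D k).2 m c y)) := by
    obtain ⟨s, hsA⟩ := hA
    refine ⟨l, le_rfl, Or.inl ⟨s, hsA, 0, (hz l le_rfl).1, fun x hx => ?_⟩⟩
    rw [hl]
    exact ⟨hP.lt s x hx, Nat.zero_le _, by simp⟩
  obtain ⟨hkl, hk⟩ := Nat.find_spec hex
  have hmin := fun j => Nat.find_min (H := hex) (m := j)
  generalize Nat.find hex = k at hkl hk hmin
  have hrow : ∀ s ∈ A, ∀ a ∈ (D k).1, (∀ x, P s x → InBlock (D k).1 n a x) →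
      (∀ u ∈ B, ∀ c ∈ (D k).2, ¬ ∀ y, Q u y → InBlock (D k).2 m c y) →
      {u | u ∈ B ∧ IsMixed M (P s) (Q u)}.ncard ≤ 4 * d := fun s _ a ha hsa hno =>
    ncard_mixed_le_of_subset_block hQ (hz k hkl).2 (he k hkl) ha hsa hno
  have hcol : ∀ u ∈ B, ∀ c ∈ (D k).2, (∀ y, Q u y → InBlock (D k).2 m c y) →
      (∀ s ∈ A, ∀ a ∈ (D k).1, ¬ ∀ x, P s x → InBlock (D k).1 n a x) →
      {s | s ∈ A ∧ IsMixed M (P s) (Q u)}.ncard ≤ 4 * d := fun u _ c hc huc hno => by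
    have := ncard_mixed_le_of_subset_block hP (hz k hkl).1 (he k hkl).transpose hc huc hno
    simpa only [isMixed_transpose] using this
  rcases k with _ | k
  · rw [h0] at hk
    rcases hk with ⟨s, hsA, a, _, hsa⟩ | ⟨u, hu, c, _, huc⟩
    · exact Or.inl ⟨s, hsA, by rw [ncard_mixed_eq_zero_of_subset_singleton hsa]; omega⟩
    · refine Or.inr ⟨u, hu, ?_⟩
      have := ncard_mixed_eq_zero_of_subset_singleton (M := fun y x => M x y) (B := A) (Q := P) huc
      simp only [isMixed_transpose] at this
      omega
  · have hprev := hmin k (Nat.lt_succ_self k)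
    simp only [not_and, not_or] at hprev
    obtain ⟨hnr, hnc⟩ := hprev (by omega)
    push Not at hnr hnc
    rcases hs k (by omega) with ⟨_, _, heq⟩ | ⟨_, _, heq⟩
    · rw [← heq] at hnc
      rcases hk with ⟨s, hsA, a, ha, hsa⟩ | ⟨u, hu, c, hc, huc⟩
      · exact Or.inl ⟨s, hsA, hrow s hsA a ha hsa (by push Not; exact hnc)⟩
      · obtain ⟨y, hy, hny⟩ := hnc u hu c hc
        exact absurd (huc y hy) hny
    · rw [← heq] at hnr
      rcases hk with ⟨s, hsA, a, ha, hsa⟩ | ⟨u, hu, c, hc, huc⟩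
      · obtain ⟨x, hx, hnx⟩ := hnr s hsA a ha
        exact absurd (hsa x hx) hnx
      · exact Or.inr ⟨u, hu, hcol u hu c hc huc (by push Not; exact hnr)⟩

/-- In a twin-ordered matrix, two interval families induce linearly many mixed zones. -/
theorem TwinOrdered.ncard_mixed_le {M : ℕ → ℕ → Bool} {n m d : ℕ} (h : TwinOrdered n m d M)
    {P Q : ℕ → ℕ → Prop} {A B : Finset ℕ} (hP : IsIntervalFamily n A P)
    (hQ : IsIntervalFamily m B Q) :
    {p : ℕ × ℕ | p.1 ∈ A ∧ p.2 ∈ B ∧ IsMixed M (P p.1) (Q p.2)}.ncard ≤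
      4 * d * (A.card + B.card) := by
  have hfin : ∀ A B : Finset ℕ,
      {p : ℕ × ℕ | p.1 ∈ A ∧ p.2 ∈ B ∧ IsMixed M (P p.1) (Q p.2)}.Finite := fun A B =>
    (A ×ˢ B).finite_toSet.subset fun p hp => by
      simpa using ⟨hp.1, hp.2.1⟩
  induction hN : A.card + B.card generalizing A B with
  | zero =>
    obtain rfl : A = ∅ := Finset.card_eq_zero.1 (by omega)
    simp
  | succ N ih =>
    rcases A.eq_empty_or_nonempty with rfl | hA
    · simp
    rcases h.exists_few_mixed hP hQ hA with ⟨s, hs, hfew⟩ | ⟨u, hu, hfew⟩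
    · have hcard := Finset.card_erase_add_one hs
      have hrec := ih (hP.mono (Finset.erase_subset s A)) hQ (by omega)
      have hsub : {p : ℕ × ℕ | p.1 ∈ A ∧ p.2 ∈ B ∧ IsMixed M (P p.1) (Q p.2)} ⊆
          {p : ℕ × ℕ | p.1 ∈ A.erase s ∧ p.2 ∈ B ∧ IsMixed M (P p.1) (Q p.2)} ∪
          Prod.mk s '' {u | u ∈ B ∧ IsMixed M (P s) (Q u)} := by
        rintro ⟨x, y⟩ ⟨hx, hy, hmix⟩
        by_cases hxs : x = s
        · subst hxs
          exact Or.inr ⟨y, ⟨hy, hmix⟩, rfl⟩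
        · exact Or.inl ⟨Finset.mem_erase.2 ⟨hxs, hx⟩, hy, hmix⟩
      have h1 := Set.ncard_le_ncard hsub
        ((hfin _ _).union ((finite_sep_mem B fun u => IsMixed M (P s) (Q u)).image _))
      have h2 := Set.ncard_union_le
        {p : ℕ × ℕ | p.1 ∈ A.erase s ∧ p.2 ∈ B ∧ IsMixed M (P p.1) (Q p.2)}
        (Prod.mk s '' {u | u ∈ B ∧ IsMixed M (P s) (Q u)})
      have h3 := Set.ncard_image_le (f := Prod.mk s)
        (finite_sep_mem B fun u => IsMixed M (P s) (Q u))
      rw [mul_add_one]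
      omega
    · have hcard := Finset.card_erase_add_one hu
      have hrec := ih hP (hQ.mono (Finset.erase_subset u B)) (by omega)
      have hsub : {p : ℕ × ℕ | p.1 ∈ A ∧ p.2 ∈ B ∧ IsMixed M (P p.1) (Q p.2)} ⊆
          {p : ℕ × ℕ | p.1 ∈ A ∧ p.2 ∈ B.erase u ∧ IsMixed M (P p.1) (Q p.2)} ∪
          (fun s => (s, u)) '' {s | s ∈ A ∧ IsMixed M (P s) (Q u)} := by
        rintro ⟨x, y⟩ ⟨hx, hy, hmix⟩
        by_cases hyu : y = u
        · subst hyu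
          exact Or.inr ⟨x, ⟨hx, hmix⟩, rfl⟩
        · exact Or.inl ⟨hx, Finset.mem_erase.2 ⟨hyu, hy⟩, hmix⟩
      have h1 := Set.ncard_le_ncard hsub
        ((hfin _ _).union ((finite_sep_mem A fun s => IsMixed M (P s) (Q u)).image _))
      have h2 := Set.ncard_union_le
        {p : ℕ × ℕ | p.1 ∈ A ∧ p.2 ∈ B.erase u ∧ IsMixed M (P p.1) (Q p.2)}
        ((fun s => (s, u)) '' {s | s ∈ A ∧ IsMixed M (P s) (Q u)})
      have h3 := Set.ncard_image_le (f := fun s => (s, u))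
        (finite_sep_mem A fun s => IsMixed M (P s) (Q u))
      rw [mul_add_one]
      omega

/-- `x` lies in the block starting at `s` or in the block directly before it; this never
holds if there is no block before `s`. -/
def InDoubleBlock (S : Finset ℕ) (n s x : ℕ) : Prop :=
  x < n ∧ (∃ s', ConsecIn S s' s ∧ s' ≤ x) ∧ ∀ t ∈ S, t ≤ x → t ≤ s

theorem ncard_inBlock_le_one (S : Finset ℕ) (n x : ℕ) :
    {s | s ∈ S ∧ InBlock S n s x}.ncard ≤ 1 := by
  rw [Set.ncard_le_one (finite_sep_mem _ _)]
  rintro a ⟨ha, hax⟩ b ⟨hb, hbx⟩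
  exact le_antisymm (hbx.2.2 a ha hax.2.1) (hax.2.2 b hb hbx.2.1)

theorem isIntervalFamily_inBlock (S : Finset ℕ) (n : ℕ) :
    IsIntervalFamily n S (InBlock S n) where
  lt _ _ h := h.1
  convex _ _ _ _ hx hz hxy hyz :=
    ⟨hyz.trans_lt hz.1, hx.2.1.trans hxy, fun t ht hty => hz.2.2 t ht (hty.trans hyz)⟩
  overlap x := (ncard_inBlock_le_one S n x).trans one_le_two

theorem isIntervalFamily_inDoubleBlock (S : Finset ℕ) (n : ℕ) :
    IsIntervalFamily n S (InDoubleBlock S n) where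
  lt _ _ h := h.1
  convex := by
    rintro s x y z ⟨_, ⟨s', hs', hsx⟩, _⟩ ⟨hzn, _, hz⟩ hxy hyz
    exact ⟨hyz.trans_lt hzn, ⟨s', hs', hsx.trans hxy⟩, fun t ht hty => hz t ht (hty.trans hyz)⟩
  overlap x := by
    have hsub : {s | s ∈ S ∧ InDoubleBlock S n s x} ⊆
        {s | s ∈ S ∧ InBlock S n s x} ∪
          {s | s ∈ S ∧ x < s ∧ ∃ s', ConsecIn S s' s ∧ s' ≤ x} := by
      rintro s ⟨hs, hxn, hs', hx⟩
      rcases lt_or_ge x s with hlt | hge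
      · exact Or.inr ⟨hs, hlt, hs'⟩
      · exact Or.inl ⟨hs, hxn, hge, hx⟩
    have hone : {s | s ∈ S ∧ x < s ∧ ∃ s', ConsecIn S s' s ∧ s' ≤ x}.ncard ≤ 1 := by
      rw [Set.ncard_le_one (finite_sep_mem _ _)]
      rintro a ⟨ha, hxa, a', ha', hax⟩ b ⟨hb, hxb, b', hb', hbx⟩
      exact le_antisymm (ha'.2.2.2 b hb (hax.trans_lt hxb)) (hb'.2.2.2 a ha (hbx.trans_lt hxa))
    calc _ ≤ _ := Set.ncard_le_ncard hsub ((finite_sep_mem _ _).union (finite_sep_mem _ _))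
      _ ≤ _ := Set.ncard_union_le _ _
      _ ≤ 1 + 1 := add_le_add (ncard_inBlock_le_one S n x) hone

theorem exists_consecIn {S : Finset ℕ} {s : ℕ} (h0 : 0 ∈ S) (hs : s ∈ S) (hne : s ≠ 0) :
    ∃ s', ConsecIn S s' s := by
  have hnonempty : (S.filter (· < s)).Nonempty :=
    ⟨0, by simp only [Finset.mem_filter]; exact ⟨h0, Nat.pos_of_ne_zero hne⟩⟩
  have hmem := Finset.max'_mem _ hnonempty
  rw [Finset.mem_filter] at hmem
  refine ⟨_, hmem.1, hs, hmem.2, fun t ht hlt => ?_⟩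
  by_contra hts
  push Not at hts
  exact absurd (Finset.le_max' (S.filter (· < s)) t (by simp [ht, hts])) (not_le.2 hlt)

theorem InBlock.inDoubleBlock {S : Finset ℕ} {n s s' x : ℕ} (hc : ConsecIn S s' s)
    (h : InBlock S n s' x ∨ InBlock S n s x) : InDoubleBlock S n s x := by
  rcases h with h | h
  · exact ⟨h.1, ⟨s', hc, h.2.1⟩, fun t ht htx => (h.2.2 t ht htx).trans hc.2.2.1.le⟩
  · exact ⟨h.1, ⟨s', hc, hc.2.2.1.le.trans h.2.1⟩, h.2.2⟩

theorem VertStripTop.isMixed {M : ℕ → ℕ → Bool} {n m : ℕ} {R C : Finset ℕ} {sr sc : ℕ}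
    (h : VertStripTop M n m R C sr sc) (hR : IsPartition n R) (hne : sr ≠ 0) :
    IsMixed M (InDoubleBlock R n sr) (InBlock C m sc) := by
  obtain ⟨hsr, _, ⟨hvert, hnc⟩, htop⟩ := h
  obtain ⟨s', hs'⟩ := exists_consecIn hR.1 hsr hne
  have hmem : InBlock R n s' s' := ⟨hR.2 s' hs'.1, le_rfl, fun _ _ ht => ht⟩
  refine ⟨fun hh => hnc fun x y x' y' hx hy hx' hy' => ?_, fun hv => ?_⟩
  · rw [hvert x x' y hx hx' hy]
    exact hh x' y y' (InBlock.inDoubleBlock hs' (Or.inr hx')) hy hy'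
  · refine htop s' hs' ⟨⟨fun x x' y hx hx' hy => ?_, fun hconst => hnc ?_⟩,
      fun x x' y hx hx' hy => ?_⟩
    · exact hv x x' y (InBlock.inDoubleBlock hs' (Or.inl hx))
        (InBlock.inDoubleBlock hs' (Or.inl hx')) hy
    · intro x y x' y' hx hy hx' hy'
      rw [hv x s' y (InBlock.inDoubleBlock hs' (Or.inr hx))
          (InBlock.inDoubleBlock hs' (Or.inl hmem)) hy,
        hv x' s' y' (InBlock.inDoubleBlock hs' (Or.inr hx'))
          (InBlock.inDoubleBlock hs' (Or.inl hmem)) hy']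
      exact hconst s' y s' y' hmem hy hmem hy'
    · exact hv x x' y (InBlock.inDoubleBlock hs' hx) (InBlock.inDoubleBlock hs' hx') hy

theorem TwinOrdered.ncard_vertStripTop_le {M : ℕ → ℕ → Bool} {n m d : ℕ}
    (h : TwinOrdered n m d M) {R C : Finset ℕ} (hR : IsPartition n R) :
    {p : ℕ × ℕ | VertStripTop M n m R C p.1 p.2}.ncard ≤
      C.card + 4 * d * (R.card + C.card) := by
  have hmixed := h.ncard_mixed_le (isIntervalFamily_inDoubleBlock R n)
    (isIntervalFamily_inBlock C m)
  have hsub : {p : ℕ × ℕ | VertStripTop M n m R C p.1 p.2} ⊆ Prod.mk 0 '' (C : Set ℕ) ∪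
      {p : ℕ × ℕ | p.1 ∈ R ∧ p.2 ∈ C ∧ IsMixed M (InDoubleBlock R n p.1) (InBlock C m p.2)} := by
    rintro ⟨sr, sc⟩ hp
    by_cases hne : sr = 0
    · subst hne
      exact Or.inl ⟨sc, hp.2.1, rfl⟩
    · exact Or.inr ⟨hp.1, hp.2.1, VertStripTop.isMixed hp hR hne⟩
  have hfin : {p : ℕ × ℕ | p.1 ∈ R ∧ p.2 ∈ C ∧
      IsMixed M (InDoubleBlock R n p.1) (InBlock C m p.2)}.Finite :=
    (R ×ˢ C).finite_toSet.subset fun p hp => by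
      simpa using ⟨hp.1, hp.2.1⟩
  have himage := Set.ncard_image_le (f := Prod.mk 0) C.finite_toSet
  rw [Set.ncard_coe_finset] at himage
  calc _ ≤ _ := Set.ncard_le_ncard hsub ((C.finite_toSet.image _).union hfin)
    _ ≤ _ := Set.ncard_union_le _ _
    _ ≤ _ := add_le_add himage hmixed

/-- For every `d` there is a constant `c` such that for every `n × n` binary matrix `M`
that is `d`-twin-ordered and every `t`-division of `M`, the total number of vertical and
horizontal strips of the division is at most `c * t`. -/
theorem strips_bound (d : ℕ) :
    ∃ c : ℕ, ∀ n : ℕ, ∀ M : ℕ → ℕ → Bool,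
      TwinOrdered n n d M →
      ∀ t : ℕ, ∀ R C : Finset ℕ, IsPartition n R → IsPartition n C →
        R.card = t → C.card = t →
        {p : ℕ × ℕ | VertStripTop M n n R C p.1 p.2}.ncard +
          {p : ℕ × ℕ | HorizStripLeft M n n R C p.1 p.2}.ncard ≤ c * t := by
  refine ⟨2 + 16 * d, fun n M h t R C hR hC hRt hCt => ?_⟩
  have hvert := h.ncard_vertStripTop_le (C := C) hR
  have hhoriz := h.transpose.ncard_vertStripTop_le (C := R) hC
  have hswap : {p : ℕ × ℕ | HorizStripLeft M n n R C p.1 p.2} =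
      Prod.swap '' {p : ℕ × ℕ | VertStripTop (fun y x => M x y) n n C R p.1 p.2} := by
    ext ⟨x, y⟩
    simp [horizStripLeft_iff_vertStripTop_transpose]
  rw [hswap, Set.ncard_image_of_injective _ Prod.swap_injective]
  rw [hRt, hCt] at hvert hhoriz
  linarith
end

section
/- Every submatrix (i.e., a zone induced by a row block and a column block) of a d-twin-ordered binary matrix is itself d-twin-ordered. -/
/-- The block starts induced on the window `[a, a + h)`, shifted to `[0, h)`. -/
def restrictStarts (a h : ℕ) (S : Finset ℕ) : Finset ℕ :=
  (Finset.range h).filter fun x => x = 0 ∨ a + x ∈ S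

theorem mem_restrictStarts {a h x : ℕ} {S : Finset ℕ} :
    x ∈ restrictStarts a h S ↔ x < h ∧ (x = 0 ∨ a + x ∈ S) := by
  simp [restrictStarts]

theorem restrictStarts_mono (a h : ℕ) {S T : Finset ℕ} (hTS : T ⊆ S) :
    restrictStarts a h T ⊆ restrictStarts a h S := by
  intro x hx
  rw [mem_restrictStarts] at hx ⊢
  exact ⟨hx.1, hx.2.imp_right fun hxT => hTS hxT⟩

theorem restrictStarts_range {a h n : ℕ} (ha : a + h ≤ n) :
    restrictStarts a h (Finset.range n) = Finset.range h := by
  ext x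
  rw [mem_restrictStarts, Finset.mem_range, Finset.mem_range]
  omega

theorem restrictStarts_singleton_zero {a h : ℕ} (hh : 1 ≤ h) :
    restrictStarts a h {0} = {0} := by
  ext x
  rw [mem_restrictStarts, Finset.mem_singleton, Finset.mem_singleton]
  omega

/-- Deleting one block start deletes at most one block start of the restriction. -/
theorem restrictStarts_eq_or_card (a h : ℕ) {S T : Finset ℕ} (hTS : T ⊆ S)
    (hcard : S.card = T.card + 1) :
    restrictStarts a h T = restrictStarts a h S ∨
      (restrictStarts a h T ⊆ restrictStarts a h S ∧
        (restrictStarts a h S).card = (restrictStarts a h T).card + 1) := by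
  have hsub := restrictStarts_mono a h hTS
  have hdiff : (restrictStarts a h S \ restrictStarts a h T).card ≤ (S \ T).card := by
    refine Finset.card_le_card_of_injOn (a + ·) ?_ fun x _ y _ hxy => Nat.add_left_cancel hxy
    intro x hx
    simp only [Finset.coe_sdiff, Set.mem_sdiff, Finset.mem_coe, mem_restrictStarts] at hx ⊢
    tauto
  have hST := Finset.card_sdiff_add_card_eq_card hTS
  have hres := Finset.card_sdiff_add_card_eq_card hsub
  by_cases heq : restrictStarts a h T = restrictStarts a h S
  · exact Or.inl heq
  · have := Finset.card_lt_card (hsub.ssubset_of_ne heq)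
    exact Or.inr ⟨hsub, by omega⟩

/-- The start of the block of the partition with starts `S` that contains `y`. -/
def blockStart (S : Finset ℕ) (y : ℕ) : ℕ :=
  Nat.findGreatest (· ∈ S) y

theorem blockStart_mem {S : Finset ℕ} (hS : 0 ∈ S) (y : ℕ) : blockStart S y ∈ S :=
  Nat.findGreatest_spec (P := (· ∈ S)) (Nat.zero_le y) hS

theorem blockStart_le (S : Finset ℕ) (y : ℕ) : blockStart S y ≤ y :=
  Nat.findGreatest_le y

theorem le_blockStart {S : Finset ℕ} {t y : ℕ} (ht : t ∈ S) (hty : t ≤ y) :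
    t ≤ blockStart S y :=
  Nat.le_findGreatest hty ht

theorem blockStart_injOn_restrictStarts (a h : ℕ) (S : Finset ℕ) :
    Set.InjOn (fun s => blockStart S (a + s)) (restrictStarts a h S) := by
  have key : ∀ s t, t ∈ restrictStarts a h S → s < t →
      blockStart S (a + s) < blockStart S (a + t) := by
    intro s t ht hst
    obtain ht0 | htS := (mem_restrictStarts.1 ht).2
    · omega
    · have := le_blockStart htS le_rfl
      have := blockStart_le S (a + s)
      omega
  intro s hs t ht hst
  dsimp only at hst
  rcases lt_trichotomy s t with hlt | heq | hlt
  · have := key s t ht hlt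
    omega
  · exact heq
  · have := key t s hs hlt
    omega

theorem InBlock.of_restrictStarts {a h n s x : ℕ} {S : Finset ℕ} (ha : a + h ≤ n)
    (hx : InBlock (restrictStarts a h S) h s x) :
    InBlock S n (blockStart S (a + s)) (a + x) := by
  obtain ⟨hxh, hsx, hmax⟩ := hx
  refine ⟨by omega, by have := blockStart_le S (a + s); omega, fun t ht htx => ?_⟩
  by_cases hts : t ≤ a + s
  · exact le_blockStart ht hts
  · have hmem : t - a ∈ restrictStarts a h S :=
      mem_restrictStarts.2 ⟨by omega, Or.inr (by rwa [show a + (t - a) = t by omega])⟩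
    have := hmax _ hmem (by omega)
    omega

/-- A property passing from restricted blocks to the blocks containing them holds for
at most as many restricted blocks as blocks. -/
theorem ncard_restrictStarts_le {a h : ℕ} {S : Finset ℕ} (hS : 0 ∈ S) {p q : ℕ → Prop}
    (hpq : ∀ s, p s → q (blockStart S (a + s))) :
    {s | s ∈ restrictStarts a h S ∧ p s}.ncard ≤ {s | s ∈ S ∧ q s}.ncard :=
  Set.ncard_le_ncard_of_injOn (fun s => blockStart S (a + s))
    (fun s hs => ⟨blockStart_mem hS _, hpq s hs.2⟩)
    ((blockStart_injOn_restrictStarts a h S).mono fun _ hs => hs.1)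
    (S.finite_toSet.subset fun _ hs => hs.1)

theorem ErrorValueLe.restrict {n m d a b h w : ℕ} {M : ℕ → ℕ → Bool} {R C : Finset ℕ}
    (ha : a + h ≤ n) (hb : b + w ≤ m) (hR : 0 ∈ R) (hC : 0 ∈ C)
    (hM : ErrorValueLe M n m R C d) :
    ErrorValueLe (fun x y => M (a + x) (b + y)) h w
      (restrictStarts a h R) (restrictStarts b w C) d := by
  have key : ∀ sr sc,
      ¬ IsConst (fun x y => M (a + x) (b + y)) (InBlock (restrictStarts a h R) h sr)
        (InBlock (restrictStarts b w C) w sc) →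
      ¬ IsConst M (InBlock R n (blockStart R (a + sr))) (InBlock C m (blockStart C (b + sc))) :=
    fun sr sc hnot hconst => hnot fun x y x' y' hx hy hx' hy' =>
      hconst _ _ _ _ (hx.of_restrictStarts ha) (hy.of_restrictStarts hb)
        (hx'.of_restrictStarts ha) (hy'.of_restrictStarts hb)
  exact ⟨fun sr _ => (ncard_restrictStarts_le hC (key sr)).trans (hM.1 _ (blockStart_mem hR _)),
    fun sc _ => (ncard_restrictStarts_le hR fun sr => key sr sc).trans
      (hM.2 _ (blockStart_mem hC _))⟩

/-- The division `Y` is obtained from the division `X` by a contraction. -/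
def IsContraction (X Y : Finset ℕ × Finset ℕ) : Prop :=
  (Y.1 ⊆ X.1 ∧ X.1.card = Y.1.card + 1 ∧ Y.2 = X.2) ∨
    (Y.2 ⊆ X.2 ∧ X.2.card = Y.2.card + 1 ∧ Y.1 = X.1)

theorem IsContraction.subset {X Y : Finset ℕ × Finset ℕ} (hXY : IsContraction X Y) :
    Y.1 ⊆ X.1 ∧ Y.2 ⊆ X.2 := by
  rcases hXY with ⟨hsub, -, heq⟩ | ⟨hsub, -, heq⟩
  · exact ⟨hsub, heq.subset⟩
  · exact ⟨heq.subset, hsub⟩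

theorem IsContraction.card_add_card {X Y : Finset ℕ × Finset ℕ} (hXY : IsContraction X Y) :
    X.1.card + X.2.card = Y.1.card + Y.2.card + 1 := by
  rcases hXY with ⟨-, hcard, heq⟩ | ⟨-, hcard, heq⟩ <;> rw [heq] <;> omega

theorem IsContraction.restrict (a h b w : ℕ) {X Y : Finset ℕ × Finset ℕ}
    (hXY : IsContraction X Y) :
    (restrictStarts a h Y.1, restrictStarts b w Y.2) =
        (restrictStarts a h X.1, restrictStarts b w X.2) ∨
      IsContraction (restrictStarts a h X.1, restrictStarts b w X.2)
        (restrictStarts a h Y.1, restrictStarts b w Y.2) := by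
  rcases hXY with ⟨hsub, hcard, heq⟩ | ⟨hsub, hcard, heq⟩
  · rcases restrictStarts_eq_or_card a h hsub hcard with hres | ⟨hres, hres'⟩
    · exact Or.inl (by rw [hres, heq])
    · exact Or.inr (Or.inl ⟨hres, hres', by rw [heq]⟩)
  · rcases restrictStarts_eq_or_card b w hsub hcard with hres | ⟨hres, hres'⟩
    · exact Or.inl (by rw [hres, heq])
    · exact Or.inr (Or.inr ⟨hres, hres', by rw [heq]⟩)

/-- Repetitions can be removed from a sequence of divisions in which each division
either equals the previous one or is a contraction of it. -/
theorem exists_contractionSequence {p : Finset ℕ × Finset ℕ → Prop}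
    (E : ℕ → Finset ℕ × Finset ℕ) (N : ℕ)
    (hE : ∀ k < N, E (k + 1) = E k ∨ IsContraction (E k) (E (k + 1)))
    (hp : ∀ k ≤ N, p (E k)) :
    ∃ (D : ℕ → Finset ℕ × Finset ℕ) (L : ℕ), D 0 = E 0 ∧ D L = E N ∧
      (∀ k < L, IsContraction (D k) (D (k + 1))) ∧ (∀ k ≤ L, p (D k)) ∧
      (E 0).1.card + (E 0).2.card = (E N).1.card + (E N).2.card + L := by
  induction N with
  | zero =>
    exact ⟨E, 0, rfl, rfl, fun k hk => absurd hk k.not_lt_zero, hp, rfl⟩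
  | succ N ih =>
    obtain ⟨D, L, hD0, hDL, hstep, hpD, hcard⟩ :=
      ih (fun k hk => hE k (by omega)) fun k hk => hp k (by omega)
    rcases hE N N.lt_succ_self with heq | hcontr
    · exact ⟨D, L, hD0, by rw [hDL, heq], hstep, hpD, by rw [hcard, heq]⟩
    · refine ⟨fun k => if k ≤ L then D k else E (N + 1), L + 1, ?_, ?_, ?_, ?_, ?_⟩
      · simpa using hD0
      · simp
      · intro k hk
        rcases (Nat.lt_succ_iff.1 hk).lt_or_eq with hlt | rfl
        · simpa [hlt.le, Nat.succ_le_of_lt hlt] using hstep k hlt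
        · simpa [hDL] using hcontr
      · intro k _
        dsimp only
        split_ifs with hkL
        · exact hpD k hkL
        · exact hp _ le_rfl
      · have := hcontr.card_add_card
        omega

/-- Every submatrix (zone induced by a row block and a column block) of a `d`-twin-ordered
binary matrix is itself `d`-twin-ordered. Here the submatrix consists of rows
`[a, a + h)` and columns `[b, b + w)` of the `n × m` matrix `M`. -/
theorem submatrix_twinOrdered (n m d a b h w : ℕ) (M : ℕ → ℕ → Bool)
    (hh : 1 ≤ h) (hw : 1 ≤ w) (ha : a + h ≤ n) (hb : b + w ≤ m)
    (hM : TwinOrdered n m d M) :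
    TwinOrdered h w d (fun x y => M (a + x) (b + y)) := by
  obtain ⟨D, hD0, hDN, hstep, herr⟩ := hM
  change ∀ k, k < _ → IsContraction (D k) (D (k + 1)) at hstep
  have hzero : ∀ k ≤ (n - 1) + (m - 1), 0 ∈ (D k).1 ∧ 0 ∈ (D k).2 := by
    intro k hk
    induction hk using Nat.decreasingInduction with
    | self => simp [hDN]
    | of_succ k hk ih => exact ⟨(hstep k hk).subset.1 ih.1, (hstep k hk).subset.2 ih.2⟩
  obtain ⟨D', L, hD'0, hD'L, hstep', herr', hcard⟩ := exists_contractionSequence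
    (p := fun X => ErrorValueLe (fun x y => M (a + x) (b + y)) h w X.1 X.2 d)
    (fun k => (restrictStarts a h (D k).1, restrictStarts b w (D k).2))
    ((n - 1) + (m - 1)) (fun k hk => (hstep k hk).restrict a h b w)
    (fun k hk => (herr k hk).restrict ha hb (hzero k hk).1 (hzero k hk).2)
  simp only [hD0, hDN, restrictStarts_range ha, restrictStarts_range hb,
    restrictStarts_singleton_zero hh, restrictStarts_singleton_zero hw, Finset.card_range,
    Finset.card_singleton] at hD'0 hD'L hcard
  obtain rfl : L = (h - 1) + (w - 1) := by omega
  exact ⟨D', hD'0, hD'L, hstep', herr'⟩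
end
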